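/- arXiv:0802.3885 — 2 statements merged into one kernel-verified Lean document; each statement's English description precedes it below -/
import Mathlib

section
/- Every trapezoidal word is rich. -/
open List

variable {α : Type*} [DecidableEq α]

/-- The set of factors (contiguous subwords) of `W`. -/
def factorFinset (W : List α) : Finset (List α) := (W.inits.flatMap List.tails).toFinset

/-- A palindrome is a word equal to its reversal. -/
def Pal (u : List α) : Prop := u.reverse = u

instance : DecidablePred (Pal : List α → Prop) :=
  fun u => inferInstanceAs (Decidable (u.reverse = u))

/-- The set of palindromic factors of `W` (including the empty word). -/
def palFactorFinset (W : List α) : Finset (List α) := (factorFinset W).filter Pal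

/-- Subword complexity: the number of distinct factors of `W` of length `n`. -/
def C (W : List α) (n : ℕ) : ℕ := ((factorFinset W).filter (fun u => u.length = n)).card

/-- Palindromic complexity: number of distinct palindromic factors of `W` of length `n`. -/
def P (W : List α) (n : ℕ) : ℕ := ((palFactorFinset W).filter (fun u => u.length = n)).card

/-- A word is rich if it has exactly `|W| + 1` distinct palindromic factors. -/
def Rich (W : List α) : Prop := (palFactorFinset W).card = W.length + 1

/-- Number of occurrences of `u` as a factor of `W`. -/
def occ (u W : List α) : ℕ := ((List.range (W.length + 1)).filter (fun i => u <+: W.drop i)).length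

/-- `Z` is a complete return to `u` in `W`: a factor of `W` with exactly two
occurrences of `u`, one as a prefix and one as a suffix. -/
def CompleteReturn (u Z W : List α) : Prop := Z <:+: W ∧ u <+: Z ∧ u <:+ Z ∧ occ u Z = 2

/-- `u` is a right special factor of `W`. -/
def RightSpecial (u W : List α) : Prop :=
  ∃ x y : α, x ≠ y ∧ (u ++ [x]) <:+: W ∧ (u ++ [y]) <:+: W

/-- `R_W`: the smallest `p` such that `W` has no right special factor of length `p`. -/
noncomputable def RW (W : List α) : ℕ := sInf {p : ℕ | ∀ u : List α, u.length = p → ¬ RightSpecial u W}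

/-- `K_W`: the length of the shortest suffix of `W` occurring exactly once in `W`. -/
noncomputable def KW (W : List α) : ℕ := sInf {k : ℕ | ∃ u : List α, u <:+ W ∧ u.length = k ∧ occ u W = 1}

/-- A word is trapezoidal if `|W| = R_W + K_W`. -/
def Trapezoidal (W : List α) : Prop := W.length = RW W + KW W

/-- The minimal period of `W`. -/
noncomputable def minPeriod (W : List α) : ℕ :=
  sInf {q : ℕ | 0 < q ∧ ∀ i : ℕ, i + q < W.length → W[i]? = W[i + q]?}

/-- A binary word is balanced if the number of occurrences of a letter in two
factors of equal length differ by at most 1. -/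
def BalancedWord (W : List Bool) : Prop :=
  ∀ u v : List Bool, u <:+: W → v <:+: W → u.length = v.length →
    u.count true ≤ v.count true + 1

/-- The length-`n` blocks of the sequence `w` starting at `i` and at `j` coincide. -/
def Agree {β : Type*} (w : ℕ → β) (i j n : ℕ) : Prop := ∀ k < n, w (i + k) = w (j + k)

/-- The block of the sequence `w` occupying the positions `i ≤ a < j` is a palindrome. -/
def PalOn {β : Type*} (w : ℕ → β) (i j : ℕ) : Prop :=
  ∀ a b, i ≤ a → i ≤ b → a + b + 1 = i + j → w a = w b

/-- The block of length `n` at `i` has an earlier occurrence, but the block of length `n + 1`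
at `i`, which lies within the first `N` positions, has none. -/
def FirstDiffers {β : Type*} (w : ℕ → β) (N i n : ℕ) : Prop :=
  i + n < N ∧ (∃ j < i, Agree w j i n) ∧ ∀ j < i, ¬ Agree w j i (n + 1)

section Sequences

variable {β : Type*} {w : ℕ → β}

lemma Agree.symm {i j n : ℕ} (h : Agree w i j n) : Agree w j i n :=
  fun k hk => (h k hk).symm

lemma Agree.trans {i j l n : ℕ} (h : Agree w i j n) (h' : Agree w j l n) : Agree w i l n :=
  fun k hk => (h k hk).trans (h' k hk)

lemma Agree.mono {i j m n : ℕ} (h : Agree w i j n) (hmn : m ≤ n) : Agree w i j m :=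
  fun k hk => h k (hk.trans_le hmn)

/-- Among two blocks of length `n + 1` differing exactly in the last letter, the first occurrence
of the one that appears later is a place where `FirstDiffers` holds. -/
lemma exists_firstDiffers {N i j n : ℕ} (hi : i + n < N) (hj : j + n < N) (hij : Agree w i j n)
    (hne : w (i + n) ≠ w (j + n)) :
    ∃ p, FirstDiffers w N p n ∧ Agree w p i n ∧ (w (p + n) = w (i + n) ∨ w (p + n) = w (j + n)) := by
  classical
  have first : ∀ i, i + n < N → ∃ p, p + n < N ∧ Agree w p i (n + 1) ∧
      ∀ q < p, ¬ Agree w q p (n + 1) := by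
    intro i hi
    have hex : ∃ p, Agree w p i (n + 1) := ⟨i, fun _ _ => rfl⟩
    refine ⟨Nat.find hex, ?_, Nat.find_spec hex, fun q hq hqp => ?_⟩
    · have := Nat.find_min' hex (m := i) (fun _ _ => rfl)
      omega
    · exact Nat.find_min hex hq (hqp.trans (Nat.find_spec hex))
  obtain ⟨p, hpN, hp, hpmin⟩ := first i hi
  obtain ⟨q, hqN, hq, hqmin⟩ := first j hj
  have hpn := hp n (by omega)
  have hqn := hq n (by omega)
  have hpi := hp.mono (Nat.le_succ n)
  have hqj := hq.mono (Nat.le_succ n)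
  have hqi := hqj.trans hij.symm
  rcases lt_trichotomy p q with hpq | rfl | hpq
  · exact ⟨q, ⟨hqN, ⟨p, hpq, hpi.trans hqi.symm⟩, hqmin⟩, hqi, Or.inr hqn⟩
  · exact absurd (hpn.symm.trans hqn) hne
  · exact ⟨p, ⟨hpN, ⟨q, hpq, hqi.trans hpi.symm⟩, hpmin⟩, hpi, Or.inl hpn⟩

lemma FirstDiffers.unique_length {N i m n : ℕ} (hm : FirstDiffers w N i m)
    (hn : FirstDiffers w N i n) : m = n := by
  obtain ⟨-, ⟨j, hj, hjm⟩, hm'⟩ := hm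
  obtain ⟨-, ⟨l, hl, hln⟩, hn'⟩ := hn
  by_contra hne
  rcases Nat.lt_or_gt_of_ne hne with h | h
  · exact hm' l hl (hln.mono h)
  · exact hn' j hj (hjm.mono h)

/-- If `FirstDiffers` is confined to `R` positions and occurs for all lengths below `R`, then it
occurs only once for each length. -/
lemma FirstDiffers.unique_position {N R : ℕ}
    (hpos : ∀ i n, FirstDiffers w N i n → i ∈ Finset.Icc 1 R)
    (hex : ∀ n < R, ∃ i, FirstDiffers w N i n) {i j n : ℕ}
    (hi : FirstDiffers w N i n) (hj : FirstDiffers w N j n) : i = j := by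
  choose! f hf using hex
  have hinj : Set.InjOn f (Finset.range R) := by
    intro a ha b hb hab
    have ha' := hf a (by simpa using ha)
    rw [hab] at ha'
    exact ha'.unique_length (hf b (by simpa using hb))
  have himg : (Finset.range R).image f = Finset.Icc 1 R := by
    apply Finset.eq_of_subset_of_card_le
    · intro x hx
      obtain ⟨a, ha, rfl⟩ := Finset.mem_image.1 hx
      exact hpos _ a (hf a (by simpa using ha))
    · rw [Finset.card_image_of_injOn hinj]
      simp
  have key : ∀ i, FirstDiffers w N i n → i = f n := by
    intro i hi
    have hmem := hpos i n hi
    rw [← himg] at hmem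
    obtain ⟨a, ha, rfl⟩ := Finset.mem_image.1 hmem
    rw [(hf a (by simpa using ha)).unique_length hi]
  rw [key i hi, key j hj]

/-- The last occurrence before `q` of the block of length `m` at `s`. -/
lemma exists_last_agree {s q m : ℕ} (hsq : s < q) :
    ∃ r, s ≤ r ∧ r < q ∧ Agree w s r m ∧ ∀ r', r < r' → r' < q → ¬ Agree w s r' m := by
  classical
  have hs : s ≤ q - 1 := by omega
  have hself : Agree w s s m := fun _ _ => rfl
  refine ⟨Nat.findGreatest (fun r => Agree w s r m) (q - 1),
    Nat.le_findGreatest hs hself, ?_, Nat.findGreatest_spec (P := fun r => Agree w s r m) hs hself,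
    fun r' h h' =>
      Nat.findGreatest_is_greatest (P := fun r => Agree w s r m) h (by omega)⟩
  have := Nat.findGreatest_le (P := fun r => Agree w s r m) (q - 1)
  omega

/-- Suppose the first `N` letters of `w` form a word over at most two letters with at most one
right special factor of each length. Then all complete returns to palindromes are palindromes. -/
theorem palOn_of_complete_return {N : ℕ}
    (hbin : ∀ i j k, i < N → j < N → k < N → w i = w j ∨ w j = w k ∨ w i = w k)
    (hspec : ∀ i j i' j' n, i + n < N → j + n < N → i' + n < N → j' + n < N →
      Agree w i j n → w (i + n) ≠ w (j + n) → Agree w i' j' n → w (i' + n) ≠ w (j' + n) →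
      Agree w i i' n)
    (m : ℕ) : ∀ s t, s < t → t + m ≤ N → Agree w s t m → PalOn w s (s + m) →
      (∀ r, s < r → r < t → ¬ Agree w s r m) → PalOn w s (t + m) := by
  induction m using Nat.twoStepInduction with
  | zero =>
    intro s t hst htN hst' hp hr a b ha hb hab
    by_cases h : s + 1 < t
    · exact absurd (fun k hk => absurd hk (Nat.not_lt_zero k)) (hr (s + 1) (by omega) h)
    · obtain rfl : a = b := by omega
      rfl
  | one =>
    intro s t hst htN hst' hp hr
    have h0 : w s = w t := hst' 0 one_pos
    have hne : ∀ r, s < r → r < t → w s ≠ w r := by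
      intro r h1 h2 h
      refine hr r h1 h2 fun k hk => ?_
      obtain rfl : k = 0 := by omega
      exact h
    intro a b ha hb hab
    rcases eq_or_lt_of_le ha with rfl | ha
    · obtain rfl : b = t := by omega
      exact h0
    rcases eq_or_lt_of_le hb with rfl | hb
    · obtain rfl : a = t := by omega
      exact h0.symm
    have h1 := hne a ha (by omega)
    have h2 := hne b hb (by omega)
    have := hbin s a b (by omega) (by omega) (by omega)
    tauto
  | more m ih _ =>
    intro s t hst htN hst' hp hr
    by_contra hnp
    -- The inner palindrome, obtained by deleting the outer letter `w s`.
    have hin : Agree w (s + 1) (t + 1) m := fun k hk => by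
      have := hst' (k + 1) (by omega)
      rwa [show s + (k + 1) = s + 1 + k by omega, show t + (k + 1) = t + 1 + k by omega] at this
    have hpin : ∀ j, Agree w (s + 1) j m → PalOn w j (j + m) := by
      intro j hj a b ha hb hab
      have h1 := hj (a - j) (by omega)
      have h2 := hj (b - j) (by omega)
      have h3 := hp (s + 1 + (a - j)) (s + 1 + (b - j)) (by omega) (by omega) (by omega)
      rw [show j + (a - j) = a by omega] at h1
      rw [show j + (b - j) = b by omega] at h2
      rw [← h1, ← h2, h3]
    have hret : ∀ q r, s + 1 ≤ q → q < r → r ≤ t + 1 → Agree w (s + 1) q m →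
        Agree w (s + 1) r m → (∀ x, q < x → x < r → ¬ Agree w (s + 1) x m) →
        PalOn w q (r + m) := fun q r h1 h2 h3 h4 h5 h6 =>
      ih q r h2 (by omega) (h4.symm.trans h5) (hpin q h4)
        fun x hx hx' h => h6 x hx hx' (h4.trans h)
    have hc1 : w (s + 1 + m) = w s := hp _ _ (by omega) (by omega) (by omega)
    have hc2 : w t = w s := (hst' 0 (by omega)).symm
    have hc3 : w (t + 1 + m) = w s := by
      have := hst' (m + 1) (by omega)
      rw [show s + (m + 1) = s + 1 + m by omega, show t + (m + 1) = t + 1 + m by omega] at this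
      rw [← this, hc1]
    -- The inner palindrome cannot be surrounded by `w s` on both sides elsewhere.
    have hout : ∀ x, s < x → x < t → Agree w (s + 1) (x + 1) m → w x = w s →
        w (x + 1 + m) ≠ w s := by
      intro x h1 h2 h3 h4 h5
      refine hr x h1 h2 fun k hk => ?_
      rcases Nat.eq_zero_or_pos k with rfl | hk0
      · exact h4.symm
      rcases Nat.lt_or_ge k (m + 1) with hk1 | hk1
      · have := h3 (k - 1) (by omega)
        rwa [show s + 1 + (k - 1) = s + k by omega, show x + 1 + (k - 1) = x + k by omega] at this
      · obtain rfl : k = m + 1 := by omega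
        rw [show s + (m + 1) = s + 1 + m by omega, show x + (m + 1) = x + 1 + m by omega, h5, hc1]
    have hmid : ∃ r, s + 1 < r ∧ r < t + 1 ∧ Agree w (s + 1) r m := by
      by_contra hno
      push Not at hno
      have hpal := hret (s + 1) (t + 1) le_rfl (by omega) le_rfl (fun _ _ => rfl) hin hno
      apply hnp
      intro a b ha hb hab
      rcases eq_or_lt_of_le ha with rfl | ha
      · obtain rfl : b = t + 1 + m := by omega
        exact hc3.symm
      rcases eq_or_lt_of_le hb with rfl | hb
      · obtain rfl : a = t + 1 + m := by omega
        exact hc3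
      exact hpal a b ha hb (by omega)
    -- `w s` followed by the inner palindrome is right special.
    obtain ⟨r₁, hr₁s, hr₁t, hr₁, hr₁c, hr₁d⟩ : ∃ r, s < r ∧ r < t ∧ Agree w (s + 1) (r + 1) m ∧
        w r = w s ∧ w (r + 1 + m) ≠ w s := by
      classical
      obtain ⟨h1, h2, h3⟩ := Nat.find_spec hmid
      have hmin := fun x => Nat.find_min (H := hmid) (m := x)
      generalize Nat.find hmid = r at *
      obtain ⟨r, rfl⟩ : ∃ r', r = r' + 1 := ⟨r - 1, by omega⟩
      have hpal := hret (s + 1) (r + 1) le_rfl h1 (by omega) (fun _ _ => rfl) h3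
        fun x hx hx' h => hmin x hx' ⟨hx, by omega, h⟩
      have hrc : w r = w s := by
        rw [← hc1]
        exact hpal _ _ (by omega) (by omega) (by omega)
      exact ⟨r, by omega, by omega, h3, hrc, hout r (by omega) (by omega) h3 hrc⟩
    -- The inner palindrome also occurs preceded by another letter and followed by `w s`.
    obtain ⟨r₂, hr₂s, hr₂t, hr₂, hr₂c, hr₂d⟩ : ∃ r, s < r ∧ r < t ∧ Agree w (s + 1) (r + 1) m ∧
        w (r + 1 + m) = w s ∧ w r ≠ w s := by
      obtain ⟨r, h1, h2, h3, h4⟩ := exists_last_agree (w := w) (m := m) (show s + 1 < t + 1 by omega)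
      obtain ⟨r', h5, h6, h7⟩ := hmid
      have hrr : r' ≤ r := by
        by_contra hlt
        exact h4 r' (by omega) h6 h7
      obtain ⟨r, rfl⟩ : ∃ r', r = r' + 1 := ⟨r - 1, by omega⟩
      have hpal := hret (r + 1) (t + 1) (by omega) (by omega) le_rfl h3 hin h4
      have hrc : w (r + 1 + m) = w s := by
        rw [← hc2]
        exact hpal _ _ (by omega) (by omega) (by omega)
      exact ⟨r, by omega, by omega, h3, hrc,
        fun h => hout r (by omega) (by omega) h3 h hrc⟩
    have hcons : ∀ x, Agree w (s + 1) (x + 1) m → ∀ y, Agree w (s + 1) (y + 1) m → w x = w y →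
        Agree w x y (m + 1) := by
      intro x hx y hy hxy k hk
      rcases Nat.eq_zero_or_pos k with rfl | hk0
      · exact hxy
      · have := (hx.symm.trans hy) (k - 1) (by omega)
        rwa [show x + 1 + (k - 1) = x + k by omega, show y + 1 + (k - 1) = y + k by omega] at this
    have hsp : ∀ i j, i + (m + 1) < N → j + (m + 1) < N → Agree w i j (m + 1) →
        w (i + (m + 1)) ≠ w (j + (m + 1)) → Agree w s i (m + 1) := by
      intro i j hi hj hij hne
      refine hspec s r₁ i j (m + 1) (by omega) (by omega) hi hj
        (hcons s (fun _ _ => rfl) r₁ hr₁ hr₁c.symm) ?_ hij hne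
      rw [show s + (m + 1) = s + 1 + m by omega, show r₁ + (m + 1) = r₁ + 1 + m by omega, hc1]
      exact hr₁d.symm
    have hdd : ∀ x, s < x → x < t → Agree w (s + 1) (x + 1) m → w x ≠ w s →
        w (x + 1 + m) = w s := by
      intro x h1 h2 h3 h4
      by_contra h5
      have hx : w x = w r₂ := by
        have := hbin s x r₂ (by omega) (by omega) (by omega)
        grind
      have := hsp x r₂ (by omega) (by omega) (hcons x h3 r₂ hr₂ hx) (by
        rw [show x + (m + 1) = x + 1 + m by omega, show r₂ + (m + 1) = r₂ + 1 + m by omega, hr₂c]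
        exact h5) 0 (by omega)
      exact h4 this.symm
    -- The first mismatch between the complete return and its reversal.
    have hmis : ∃ k, s + k ≤ t + 1 + m ∧ w (s + k) ≠ w (t + 1 + m - k) := by
      by_contra hno
      push Not at hno
      apply hnp
      intro a b ha hb hab
      have := hno (a - s) (by omega)
      rwa [show s + (a - s) = a by omega, show t + 1 + m - (a - s) = b by omega] at this
    classical
    obtain ⟨hk1, hk2⟩ := Nat.find_spec hmis
    have hkmin := fun x => Nat.find_min (H := hmis) (m := x)
    generalize Nat.find hmis = k at *
    have hborder : ∀ x, x < m + 2 → w (s + x) = w (t + 1 + m - x) := by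
      intro x hx
      have h1 := hst' (m + 1 - x) (by omega)
      rw [show t + (m + 1 - x) = t + 1 + m - x by omega] at h1
      rw [← h1]
      exact hp _ _ (by omega) (by omega) (by omega)
    have hkm : m + 2 ≤ k := by
      by_contra hlt
      exact hk2 (hborder k (by omega))
    have hkt : s + k < t := by
      by_contra hlt
      have := hborder (t + 1 + m - s - k) (by omega)
      rw [show s + (t + 1 + m - s - k) = t + 1 + m - k by omega,
        show t + 1 + m - (t + 1 + m - s - k) = s + k by omega] at this
      exact hk2 this.symm
    have hmir : ∀ a b, s ≤ a → a < s + k → a + b = s + t + 1 + m → w a = w b := by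
      intro a b ha ha' hab
      by_contra hne
      refine hkmin (a - s) (by omega) ⟨by omega, ?_⟩
      rwa [show s + (a - s) = a by omega, show t + 1 + m - (a - s) = b by omega]
    have hmirA : ∀ x y, s + 1 ≤ x → s + 1 ≤ y → x + y = s + t + 2 →
        (x + m ≤ s + k ∨ y + m ≤ s + k) →
        Agree w (s + 1) x m → Agree w (s + 1) y m := by
      intro x y hx hy hxy hor hxa i hi
      rw [hxa i hi, hpin x hxa (x + i) (x + (m - 1 - i)) (by omega) (by omega) (by omega)]
      rcases hor with h | h
      · exact hmir _ _ (by omega) (by omega) (by omega)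
      · exact (hmir _ _ (by omega) (by omega) (by omega)).symm
    obtain ⟨r, hrs, hrk, hra, hrmax⟩ :=
      exists_last_agree (w := w) (m := m) (show s + 1 < s + k - m + 1 by omega)
    obtain ⟨r', hr'⟩ : ∃ r', r + r' = s + t + 2 := ⟨s + t + 2 - r, by omega⟩
    have hra' := hmirA r r' hrs (by omega) hr' (Or.inl (by omega)) hra
    rcases eq_or_lt_of_le (show r + m ≤ s + k by omega) with heq | hlt
    · obtain ⟨x, rfl⟩ : ∃ x, r = x + 1 := ⟨r - 1, by omega⟩
      obtain ⟨y, rfl⟩ : ∃ y, r' = y + 1 := ⟨r' - 1, by omega⟩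
      have h1 : w x = w (y + 1 + m) := hmir _ _ (by omega) (by omega) (by omega)
      rw [← heq, show t + 1 + m - k = y by omega] at hk2
      have h2 := hout x (by omega) (by omega) hra
      have h3 := hout y (by omega) (by omega) hra'
      have h4 := hdd x (by omega) (by omega) hra
      have h5 := hdd y (by omega) (by omega) hra'
      have h6 := hbin s (x + 1 + m) y (by omega) (by omega) (by omega)
      grind
    · obtain ⟨l, hl⟩ : ∃ l, r + m + (l + 1) = s + k := ⟨s + k - r - m - 1, by omega⟩
      obtain ⟨q, hqs, hqr, hqa, hqmax⟩ :=
        exists_last_agree (w := w) (m := m) (show s + 1 < r' by omega)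
      have hpal := hret q r' hqs hqr (by omega) hqa hra' hqmax
      have hqk : q + k ≤ t + m + 1 := by
        by_contra hgt
        exact hrmax (s + t + 2 - q) (by omega) (by omega)
          (hmirA q _ hqs (by omega) (by omega) (Or.inr (by omega)) hqa)
      have hrq : Agree w r q (m + (l + 1)) := by
        intro i hi
        rw [hpal (q + i) (r' + m - 1 - i) (by omega) (by omega) (by omega)]
        exact hmir _ _ (by omega) (by omega) (by omega)
      have hne : w (r + (m + (l + 1))) ≠ w (q + (m + (l + 1))) := by
        rw [hpal (q + (m + (l + 1))) (t + 1 + m - k) (by omega) (by omega) (by omega),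
          show r + (m + (l + 1)) = s + k by omega]
        exact hk2
      have hfin := hsp (r + l) (q + l) (by omega) (by omega)
        (fun i hi => by
          have := hrq (l + i) (by omega)
          rwa [← add_assoc, ← add_assoc] at this)
        (by rwa [show r + l + (m + 1) = r + (m + (l + 1)) by omega,
          show q + l + (m + 1) = q + (m + (l + 1)) by omega])
      refine hrmax (r + l + 1) (by omega) (by omega) fun i hi => ?_
      have := hfin (i + 1) (by omega)
      rwa [show s + (i + 1) = s + 1 + i by omega, show r + l + (i + 1) = r + l + 1 + i by omega]
        at this

end Sequences

lemma agree_of_infix_concat {α : Type*} {W u : List α} {x y : α} (hx : u ++ [x] <:+: W)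
    (hy : u ++ [y] <:+: W) (hxy : x ≠ y) :
    ∃ i j, i + u.length < W.length ∧ j + u.length < W.length ∧
      Agree (W[·]?) i j u.length ∧ W[i + u.length]? ≠ W[j + u.length]? := by
  obtain ⟨i, hi, hix⟩ := infix_iff_getElem?.1 hx
  obtain ⟨j, hj, hjy⟩ := infix_iff_getElem?.1 hy
  simp only [length_append, length_singleton] at hi hj hix hjy
  refine ⟨i, j, by omega, by omega, fun k hk => ?_, ?_⟩
  · have h1 := hix k (by omega)
    have h2 := hjy k (by omega)
    rw [getElem_append_left hk] at h1 h2
    change W[i + k]? = W[j + k]?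
    rw [add_comm i, add_comm j, h1, h2]
  · have h1 := hix u.length (by omega)
    have h2 := hjy u.length (by omega)
    rw [getElem_concat_length rfl] at h1 h2
    rw [add_comm i, add_comm j, h1, h2]
    simpa using hxy

lemma exists_agree_of_lt_RW {α : Type*} {W : List α} {n : ℕ} (hn : n < RW W) :
    ∃ i j, i + n < W.length ∧ j + n < W.length ∧
      Agree (W[·]?) i j n ∧ W[i + n]? ≠ W[j + n]? := by
  have := Nat.notMem_of_lt_sInf hn
  rw [Set.mem_ofPred_eq] at this
  push Not at this
  obtain ⟨u, rfl, x, y, hxy, hx, hy⟩ := this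
  exact agree_of_infix_concat hx hy hxy

lemma exists_agree_of_lt_KW {W : List α} {i : ℕ} (hi : i ≤ W.length)
    (hiK : W.length < i + KW W) :
    ∃ j < i, Agree (W[·]?) j i (W.length - i) := by
  have hocc : occ (W.drop i) W ≠ 1 := fun h =>
    Nat.notMem_of_lt_sInf (show W.length - i < KW W by omega)
      ⟨W.drop i, drop_suffix _ _, by simp, h⟩
  have hnodup : ((List.range (W.length + 1)).filter (fun j => W.drop i <+: W.drop j)).Nodup :=
    nodup_range.filter _
  obtain ⟨j, hj, hji⟩ : ∃ j ∈ (List.range (W.length + 1)).filter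
      (fun j => W.drop i <+: W.drop j), j ≠ i := by
    by_contra hno
    push Not at hno
    apply hocc
    have hmem : i ∈ (List.range (W.length + 1)).filter (fun j => W.drop i <+: W.drop j) := by
      simp
      omega
    have hrep := eq_replicate_of_mem hno
    rw [hrep, nodup_replicate] at hnodup
    exact le_antisymm hnodup (length_pos_of_mem hmem)
  simp only [mem_filter, mem_range, decide_eq_true_eq] at hj
  obtain ⟨hj, hpre⟩ := hj
  have hle := hpre.length_le
  simp only [length_drop] at hle
  refine ⟨j, by omega, fun k hk => ?_⟩
  have := prefix_iff_getElem?.1 hpre k (by simpa using hk)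
  rw [getElem?_drop, ← getElem?_eq_getElem, getElem?_drop] at this
  exact this

/-- Complete returns to palindromic factors of a trapezoidal word are palindromes. -/
theorem Trapezoidal.palOn_of_complete_return {W : List α} (h : Trapezoidal W) {m s t : ℕ}
    (hst : s < t) (htW : t + m ≤ W.length) (hagree : Agree (W[·]?) s t m)
    (hpal : PalOn (W[·]?) s (s + m))
    (hret : ∀ r, s < r → r < t → ¬ Agree (W[·]?) s r m) : PalOn (W[·]?) s (t + m) := by
  have hlen : W.length = RW W + KW W := h
  have hpos : ∀ i n, FirstDiffers (W[·]?) W.length i n → i ∈ Finset.Icc 1 (RW W) := by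
    rintro i n ⟨hi, ⟨j, hj, -⟩, hfirst⟩
    rw [Finset.mem_Icc]
    refine ⟨by omega, ?_⟩
    by_contra hiR
    obtain ⟨l, hl, hli⟩ := exists_agree_of_lt_KW (W := W) (i := i) (by omega) (by omega)
    exact hfirst l hl (hli.mono (by omega))
  have huniq : ∀ i j n, FirstDiffers (W[·]?) W.length i n →
      FirstDiffers (W[·]?) W.length j n → i = j := fun i j n =>
    FirstDiffers.unique_position hpos (fun n hn => by
      obtain ⟨i, j, hi, hj, hij, hne⟩ := exists_agree_of_lt_RW hn
      obtain ⟨p, hp, -⟩ := exists_firstDiffers hi hj hij hne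
      exact ⟨p, hp⟩)
  refine _root_.palOn_of_complete_return (w := (W[·]?)) (N := W.length) ?_ ?_ m s t hst htW
    hagree hpal hret
  · intro i j k hi hj hk
    by_contra hne
    push Not at hne
    obtain ⟨hij, hjk, hik⟩ := hne
    have h0 : ∀ i j, Agree (W[·]?) i j 0 := fun i j k hk => absurd hk (Nat.not_lt_zero k)
    obtain ⟨p, hp, -, hp'⟩ := exists_firstDiffers (n := 0) hi hj (h0 i j) hij
    obtain ⟨q, hq, -, hq'⟩ := exists_firstDiffers (n := 0) hj hk (h0 j k) hjk
    obtain ⟨r, hr, -, hr'⟩ := exists_firstDiffers (n := 0) hi hk (h0 i k) hik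
    obtain rfl := huniq p q 0 hp hq
    obtain rfl := huniq p r 0 hp hr
    simp only [add_zero] at hp' hq' hr'
    grind
  · intro i j i' j' n hi hj hi' hj' hij hne hij' hne'
    obtain ⟨p, hp, hpi, -⟩ := exists_firstDiffers hi hj hij hne
    obtain ⟨q, hq, hqi, -⟩ := exists_firstDiffers hi' hj' hij' hne'
    obtain rfl := huniq p q n hp hq
    exact hpi.symm.trans hqi

lemma mem_palFactorFinset {u W : List α} : u ∈ palFactorFinset W ↔ u <:+: W ∧ u.reverse = u := by
  simp only [palFactorFinset, factorFinset, Finset.mem_filter, mem_toFinset, mem_flatMap,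
    mem_inits, mem_tails, infix_iff_suffix_prefix, Pal]
  simp only [and_comm]

lemma reverse_eq_iff_palOn {α : Type*} {W : List α} {i n : ℕ} (hn : n ≤ W.length) (hi : i ≤ n) :
    ((W.take n).drop i).reverse = (W.take n).drop i ↔ PalOn (W[·]?) i n := by
  have hlen : ((W.take n).drop i).length = n - i := by simp; omega
  constructor
  · intro h a b ha hb hab
    have h1 : ((W.take n).drop i).reverse[a - i]? = ((W.take n).drop i)[a - i]? := by rw [h]
    rw [getElem?_reverse (by omega), hlen, getElem?_drop, getElem?_drop, getElem?_take,
      getElem?_take, if_pos (by omega), if_pos (by omega), show i + (a - i) = a by omega,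
      show i + (n - i - 1 - (a - i)) = b by omega] at h1
    exact h1.symm
  · intro h
    apply ext_getElem?
    intro k
    by_cases hk : k < n - i
    · rw [getElem?_reverse (by omega), hlen, getElem?_drop, getElem?_drop, getElem?_take,
        getElem?_take, if_pos (by omega), if_pos (by omega)]
      exact h _ _ (by omega) (by omega) (by omega)
    · rw [getElem?_eq_none (by rw [length_reverse]; omega), getElem?_eq_none (by omega)]

lemma drop_take_infix_take_iff {α : Type*} {W : List α} {i n m : ℕ} (hn : n ≤ W.length) (hi : i ≤ n)
    (hm : m ≤ W.length) :
    (W.take n).drop i <:+: W.take m ↔ ∃ j, j + (n - i) ≤ m ∧ Agree (W[·]?) j i (n - i) := by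
  have hlen : ((W.take n).drop i).length = n - i := by simp; omega
  rw [infix_iff_getElem?]
  refine exists_congr fun j => ⟨fun ⟨hj, h⟩ => ?_, fun ⟨hj, h⟩ => ?_⟩
  · rw [hlen, length_take] at hj
    refine ⟨by omega, fun k hk => ?_⟩
    have h1 := h k (by omega)
    rw [← getElem?_eq_getElem, getElem?_take, getElem?_drop, getElem?_take, if_pos (by omega),
      if_pos (by omega), add_comm k] at h1
    exact h1
  · refine ⟨by rw [hlen, length_take]; omega, fun k hk => ?_⟩
    rw [← getElem?_eq_getElem, getElem?_take, getElem?_drop, getElem?_take, if_pos (by omega),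
      if_pos (by omega), add_comm k]
    exact h k (by omega)

/-- A word in which all complete returns to palindromes are palindromes is rich. -/
theorem rich_of_palOn_of_complete_return {W : List α}
    (h : ∀ m s t, s < t → t + m ≤ W.length → Agree (W[·]?) s t m → PalOn (W[·]?) s (s + m) →
      (∀ r, s < r → r < t → ¬ Agree (W[·]?) s r m) → PalOn (W[·]?) s (t + m)) : Rich W := by
  suffices key : ∀ n ≤ W.length, (palFactorFinset (W.take n)).card = n + 1 by
    simpa [Rich] using key W.length le_rfl
  intro n
  induction n with
  | zero =>
    intro _
    have : palFactorFinset (W.take 0) = {[]} := by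
      ext u
      simp +contextual [mem_palFactorFinset]
    rw [this]
    rfl
  | succ n ih =>
    intro hn
    classical
    have hex : ∃ i, i ≤ n + 1 ∧ PalOn (W[·]?) i (n + 1) :=
      ⟨n + 1, le_rfl, fun a b ha hb hab => by omega⟩
    obtain ⟨hi, hp⟩ := Nat.find_spec hex
    have hmin := fun x => Nat.find_min (H := hex) (m := x)
    generalize Nat.find hex = i at *
    have hin : i ≤ n := by
      by_contra hlt
      refine hmin n (by omega) ⟨by omega, fun a b ha hb hab => ?_⟩
      obtain rfl : a = b := by omega
      rfl
    have hnew : (W.take (n + 1)).drop i ∉ palFactorFinset (W.take n) := by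
      rw [mem_palFactorFinset, drop_take_infix_take_iff hn hi (by omega)]
      rintro ⟨⟨j, hj, hji⟩, -⟩
      obtain ⟨r, hjr, hri, hr, hrmax⟩ := exists_last_agree (w := (W[·]?)) (m := n + 1 - i)
        (show j < i by omega)
      have hri' := hr.symm.trans hji
      have hpal := h (n + 1 - i) r i hri (by omega) hri' (fun a b ha hb hab => by
        have h1 := hri' (a - r) (by omega)
        have h2 := hri' (b - r) (by omega)
        have h3 := hp (i + (a - r)) (i + (b - r)) (by omega) (by omega) (by omega)
        rw [show r + (a - r) = a by omega] at h1
        rw [show r + (b - r) = b by omega] at h2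
        exact h1.trans (h3.trans h2.symm))
        (fun x hx hx' hax => hrmax x hx hx' (hr.trans hax))
      rw [show i + (n + 1 - i) = n + 1 by omega] at hpal
      exact hmin r hri ⟨by omega, hpal⟩
    have hins : palFactorFinset (W.take (n + 1)) =
        insert ((W.take (n + 1)).drop i) (palFactorFinset (W.take n)) := by
      ext u
      rw [Finset.mem_insert, mem_palFactorFinset, mem_palFactorFinset]
      constructor
      · rintro ⟨hu, hrev⟩
        by_cases hun : u <:+: W.take n
        · exact Or.inr ⟨hun, hrev⟩
        left
        have hsuf : u <:+ W.take (n + 1) := by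
          rw [take_add_one, getElem?_eq_getElem (by omega)] at hu ⊢
          exact (infix_concat_iff.1 hu).resolve_right hun
        obtain ⟨x, hx, rfl⟩ : ∃ x ≤ n + 1, u = (W.take (n + 1)).drop x :=
          ⟨_, by simp, suffix_iff_eq_drop.1 hsuf⟩
        have hxp := (reverse_eq_iff_palOn hn hx).1 hrev
        rcases lt_trichotomy x i with hlt | rfl | hlt
        · exact absurd ⟨hx, hxp⟩ (hmin x hlt)
        · rfl
        · refine absurd ((drop_take_infix_take_iff hn hx (by omega)).2
            ⟨i, by omega, fun k hk => ?_⟩) hun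
          have h1 := hp (i + k) (n - k) (by omega) (by omega) (by omega)
          exact h1.trans (hxp _ _ (by omega) (by omega) (by omega))
      · rintro (rfl | ⟨hu, hrev⟩)
        · exact ⟨(drop_suffix _ _).isInfix, (reverse_eq_iff_palOn hn hi).2 hp⟩
        · exact ⟨hu.trans (take_prefix_take_left (by omega)).isInfix, hrev⟩
    rw [hins, Finset.card_insert_of_notMem hnew, ih (by omega)]

theorem stmt5 {α : Type*} [DecidableEq α] (W : List α) (h : Trapezoidal W) : Rich W :=
  rich_of_palOn_of_complete_return fun _ _ _ => h.palOn_of_complete_return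
end

section
/- Let W be a finite binary palindrome of length N such that P_W(n) + P_W(N-n) = 2 for all 0 ≤ n ≤ N. Then W is balanced, i.e., W is a finite Sturmian word. -/
open List

variable {α : Type*} [DecidableEq α]

namespace PalComplexity

/-- The list of the `l` letters of `w` starting at position `a`. -/
def window (w : ℕ → Bool) (a l : ℕ) : List Bool := (List.range l).map fun t => w (a + t)

/-- The window of length `l` at position `a` reads the same in both directions. -/
def WindowPal (w : ℕ → Bool) (a l : ℕ) : Prop := ∀ t < l, w (a + t) = w (a + (l - 1 - t))

/-- The windows of length `l` at positions `a` and `b` coincide. -/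
def SameWindow (w : ℕ → Bool) (a b l : ℕ) : Prop := ∀ t < l, w (a + t) = w (b + t)

@[simp] lemma length_window (w : ℕ → Bool) (a l : ℕ) : (window w a l).length = l := by
  simp [window]

lemma window_eq_iff {w : ℕ → Bool} {a b l : ℕ} :
    window w a l = window w b l ↔ SameWindow w a b l := by
  simp [window, SameWindow]

lemma pal_window_iff {w : ℕ → Bool} {a l : ℕ} : Pal (window w a l) ↔ WindowPal w a l := by
  unfold Pal WindowPal
  rw [List.ext_getElem_iff]
  constructor
  · rintro ⟨-, h⟩ t ht
    have := h t (by simpa using ht) (by simpa using ht)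
    simpa [window] using this.symm
  · intro h
    refine ⟨by simp, fun t h₁ h₂ => ?_⟩
    have := h t (by simpa using h₂)
    simpa [window] using this.symm

lemma count_window_add (w : ℕ → Bool) (a k l : ℕ) :
    (window w a (k + l)).count true =
      (window w a k).count true + (window w (a + k) l).count true := by
  rw [← List.count_append]
  congr 1
  simp [window, List.range_add, Function.comp_def, add_assoc]

lemma toNat_injective : Function.Injective Bool.toNat := by
  decide

lemma count_window_one (w : ℕ → Bool) (a : ℕ) :
    (window w a 1).count true = (w a).toNat := by
  cases h : w a <;> simp [window, h]

/-- A palindromic window restricts to centred palindromic windows. -/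
lemma WindowPal.center {w : ℕ → Bool} {a l : ℕ} (h : WindowPal w a l) {r k : ℕ}
    (hl : l = k + 2 * r) : WindowPal w (a + r) k := by
  intro t ht
  have := h (r + t) (by omega)
  rw [show a + r + t = a + (r + t) by ring, this]
  congr 1
  omega

/-- The letters of a list, extended by `false`. -/
def letter (W : List Bool) (k : ℕ) : Bool := W.getD k false

lemma mem_factorFinset {W u : List Bool} : u ∈ factorFinset W ↔ u <:+: W := by
  simp only [factorFinset, List.mem_toFinset, List.mem_flatMap, List.mem_inits, List.mem_tails]
  constructor
  · rintro ⟨v, hv, hu⟩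
    exact hu.isInfix.trans hv.isInfix
  · rintro ⟨s, t, h⟩
    exact ⟨s ++ u, ⟨t, h⟩, ⟨s, rfl⟩⟩

lemma isInfix_iff {W u : List Bool} :
    u <:+: W ↔ ∃ a, a + u.length ≤ W.length ∧ u = window (letter W) a u.length := by
  constructor
  · rintro ⟨s, t, rfl⟩
    refine ⟨s.length, by simp, ?_⟩
    apply List.ext_getElem (by simp)
    intro k h₁ h₂
    simp [window, letter, List.getElem?_append, h₁]
  · rintro ⟨a, ha, hu⟩
    have : u = (W.drop a).take u.length := by
      apply List.ext_getElem (by simp; omega)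
      intro k h₁ h₂
      rw [List.getElem_of_eq hu]
      have : a + k < W.length := by omega
      simp [window, letter, this]
    rw [this]
    exact (List.take_prefix _ _).isInfix.trans (List.drop_suffix _ _).isInfix

lemma window_isInfix {W : List Bool} {a l : ℕ} (h : a + l ≤ W.length) :
    window (letter W) a l <:+: W :=
  isInfix_iff.2 ⟨a, by simpa using h, by simp⟩

/-- The palindromic factors of `W` of length `n`. -/
abbrev palOfLength (W : List Bool) (n : ℕ) : Finset (List Bool) :=
  (palFactorFinset W).filter (fun u => u.length = n)

lemma window_mem {W : List Bool} {a n : ℕ} (h : a + n ≤ W.length)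
    (hp : WindowPal (letter W) a n) : window (letter W) a n ∈ palOfLength W n := by
  simp [palFactorFinset, mem_factorFinset, window_isInfix h, pal_window_iff.2 hp]

lemma windowPal_whole {W : List Bool} (hpal : Pal W) : WindowPal (letter W) 0 W.length := by
  rw [← pal_window_iff]
  convert hpal
  have := (isInfix_iff.1 (List.infix_refl W))
  obtain ⟨a, ha, hW⟩ := this
  obtain rfl : a = 0 := by omega
  exact hW.symm

lemma P_le_two {W : List Bool} (h : ∀ n : ℕ, n ≤ W.length → P W n + P W (W.length - n) = 2)
    {n : ℕ} (hn : n ≤ W.length) : P W n ≤ 2 := by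
  have := h n hn
  omega

lemma P_even_le_one {W : List Bool} (hpal : Pal W)
    (h : ∀ n : ℕ, n ≤ W.length → P W n + P W (W.length - n) = 2)
    {n : ℕ} (hn : n ≤ W.length) (he : Even n) : P W n ≤ 1 := by
  obtain ⟨r, rfl⟩ := he
  have hc := (windowPal_whole hpal).center (r := r) (k := W.length - (r + r)) (by omega)
  have : 0 < P W (W.length - (r + r)) :=
    Finset.card_pos.2 ⟨_, window_mem (by omega) hc⟩
  have := h _ hn
  omega

lemma same_of_even {W : List Bool} (hpal : Pal W)
    (h : ∀ n : ℕ, n ≤ W.length → P W n + P W (W.length - n) = 2)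
    {a b n : ℕ} (he : Even n) (ha : a + n ≤ W.length) (hb : b + n ≤ W.length)
    (hpa : WindowPal (letter W) a n) (hpb : WindowPal (letter W) b n) :
    SameWindow (letter W) a b n :=
  window_eq_iff.1 <| Finset.card_le_one.1 (P_even_le_one hpal h (by omega) he) _
    (window_mem ha hpa) _ (window_mem hb hpb)

lemma same_or_same {W : List Bool}
    (h : ∀ n : ℕ, n ≤ W.length → P W n + P W (W.length - n) = 2)
    {a b c n : ℕ} (ha : a + n ≤ W.length) (hb : b + n ≤ W.length) (hc : c + n ≤ W.length)
    (hpa : WindowPal (letter W) a n) (hpb : WindowPal (letter W) b n)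
    (hpc : WindowPal (letter W) c n) (hab : ¬ SameWindow (letter W) a b n) :
    SameWindow (letter W) a c n ∨ SameWindow (letter W) b c n := by
  by_contra! hne
  have : 2 < P W n := Finset.two_lt_card.2 ⟨_, window_mem ha hpa, _, window_mem hb hpb, _,
    window_mem hc hpc, by rwa [Ne, window_eq_iff], by rw [Ne, window_eq_iff]; exact hne.1,
    by rw [Ne, window_eq_iff]; exact hne.2⟩
  have := P_le_two h (n := n) (by omega)
  omega

lemma card_palFactorFinset {W : List Bool}
    (h : ∀ n : ℕ, n ≤ W.length → P W n + P W (W.length - n) = 2) :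
    (palFactorFinset W).card = W.length + 1 := by
  have h₁ : (palFactorFinset W).card = ∑ n ∈ Finset.range (W.length + 1), P W n := by
    apply Finset.card_eq_sum_card_fiberwise (f := List.length)
    intro u hu
    simp only [palFactorFinset, Finset.coe_filter, mem_factorFinset, Set.mem_ofPred_eq] at hu
    have := hu.1.length_le
    simp only [Finset.coe_range, Set.mem_Iio]
    omega
  have h₂ := Finset.sum_range_reflect (fun n => P W n) (W.length + 1)
  have h₃ : ∑ n ∈ Finset.range (W.length + 1), (P W n + P W (W.length + 1 - 1 - n)) =
      ∑ n ∈ Finset.range (W.length + 1), 2 := by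
    refine Finset.sum_congr rfl fun n hn => ?_
    have := Finset.mem_range.1 hn
    exact h n (by omega)
  rw [Finset.sum_add_distrib, h₂] at h₃
  simp at h₃
  omega

/-- `u` occurs in `W` with its last letter just before position `e`. -/
def EndsAt (W u : List Bool) (e : ℕ) : Prop :=
  e ≤ W.length ∧ u.length ≤ e ∧ window (letter W) (e - u.length) u.length = u

lemma exists_endsAt {W u : List Bool} (hu : u <:+: W) : ∃ e, EndsAt W u e := by
  obtain ⟨a, ha, hu⟩ := isInfix_iff.1 hu
  exact ⟨a + u.length, ha, by omega, by simpa using hu.symm⟩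

/-- The position just after the first occurrence of `u` in `W`. -/
noncomputable def firstEnd (W u : List Bool) : ℕ := sInf {e | EndsAt W u e}

lemma endsAt_firstEnd {W u : List Bool} (hu : u <:+: W) : EndsAt W u (firstEnd W u) :=
  Nat.sInf_mem (exists_endsAt hu)

/-- A palindromic suffix of a palindrome is also a prefix of it. -/
lemma WindowPal.same_of_suffix {w : ℕ → Bool} {a l k : ℕ} (h : WindowPal w a l)
    (hk : k ≤ l) (hs : WindowPal w (a + (l - k)) k) : SameWindow w a (a + (l - k)) k := by
  intro t ht
  rw [h t (by omega), hs t ht]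
  congr 1
  omega

lemma firstEnd_injOn_aux {W u v : List Bool} (hu : u <:+: W) (hv : v <:+: W) (pu : Pal u)
    (pv : Pal v) (he : firstEnd W u = firstEnd W v) (hl : u.length < v.length) : False := by
  obtain ⟨h₁, h₂, h₃⟩ := endsAt_firstEnd hu
  obtain ⟨-, h₅, h₆⟩ := endsAt_firstEnd hv
  rw [← he] at h₅ h₆
  generalize hE : firstEnd W u = e at *
  rw [← h₃, pal_window_iff] at pu
  rw [← h₆, pal_window_iff] at pv
  have hs : SameWindow (letter W) (e - v.length) (e - u.length) u.length := by
    have hh := pv.same_of_suffix hl.le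
    rw [show e - v.length + (v.length - u.length) = e - u.length by omega] at hh
    apply hh
    simpa using pu
  have hend : EndsAt W u (e - v.length + u.length) := by
    refine ⟨by omega, by omega, ?_⟩
    rw [Nat.add_sub_cancel, window_eq_iff.2 hs, h₃]
  have : firstEnd W u ≤ _ := Nat.sInf_le hend
  omega

lemma firstEnd_injOn (W : List Bool) : Set.InjOn (firstEnd W) (palFactorFinset W) := by
  intro u hu v hv he
  simp only [palFactorFinset, Finset.coe_filter, mem_factorFinset, Set.mem_ofPred_eq] at hu hv
  rcases lt_trichotomy u.length v.length with hl | hl | hl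
  · exact (firstEnd_injOn_aux hu.1 hv.1 hu.2 hv.2 he hl).elim
  · have h₁ := (endsAt_firstEnd hu.1).2.2
    have h₂ := (endsAt_firstEnd hv.1).2.2
    rw [← h₁, ← h₂, he, hl]
  · exact (firstEnd_injOn_aux hv.1 hu.1 hv.2 hu.2 he.symm hl).elim

/-- In a rich word every prefix has a palindromic suffix that occurs in it only once. -/
lemma exists_unioccurrent {W : List Bool} (hr : (palFactorFinset W).card = W.length + 1)
    {e : ℕ} (he : e ≤ W.length) : ∃ a l, a + l = e ∧ WindowPal (letter W) a l ∧
      ∀ b < a, ¬ SameWindow (letter W) b a l := by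
  have hmaps : Set.MapsTo (firstEnd W) (palFactorFinset W) (Finset.range (W.length + 1)) := by
    intro u hu
    simp only [palFactorFinset, Finset.coe_filter, mem_factorFinset, Set.mem_ofPred_eq] at hu
    have := (endsAt_firstEnd hu.1).1
    simp only [Finset.coe_range, Set.mem_Iio]
    omega
  have hsurj := Finset.surjOn_of_injOn_of_card_le (firstEnd W) hmaps (firstEnd_injOn W)
    (by simp [hr])
  obtain ⟨u, hu, hue⟩ := hsurj (show e ∈ _ by simpa using Nat.lt_succ_of_le he)
  simp only [palFactorFinset, Finset.coe_filter, mem_factorFinset, Set.mem_ofPred_eq] at hu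
  obtain ⟨h₁, h₂, h₃⟩ := endsAt_firstEnd hu.1
  rw [hue] at h₂ h₃
  refine ⟨e - u.length, u.length, by omega, ?_, fun b hb hs => ?_⟩
  · rw [← pal_window_iff, h₃]
    exact hu.2
  · have hend : EndsAt W u (b + u.length) := by
      refine ⟨by omega, by omega, ?_⟩
      rw [Nat.add_sub_cancel, window_eq_iff.2 hs, h₃]
    have : firstEnd W u ≤ _ := Nat.sInf_le hend
    omega

lemma SameWindow.windowPal {w : ℕ → Bool} {a b l : ℕ} (h : SameWindow w a b l)
    (hb : WindowPal w b l) : WindowPal w a l := by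
  intro t ht
  rw [h t ht, hb t ht, h _ (by omega)]

/-- Reflecting an occurrence of a palindrome inside a palindrome. -/
lemma WindowPal.reflect {w : ℕ → Bool} {a l c m k k' : ℕ} (h : WindowPal w a l)
    (hc : WindowPal w c m) (hk : SameWindow w k c m) (hak : a ≤ k) (hkl : k + m ≤ a + l)
    (hk' : k' + k + m = a + a + l) : SameWindow w k' c m := by
  intro t ht
  rw [hc t ht, ← hk _ (by omega), show k' + t = a + (k' - a + t) by omega, h _ (by omega)]
  congr 1
  omega

/-- In a rich word the factor spanned by two consecutive occurrences, at positions `d < d'`, of a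
palindrome is a palindrome. The palindrome is the window of length `m` at position `c`. -/
lemma windowPal_of_consecutive {W : List Bool} (hr : (palFactorFinset W).card = W.length + 1)
    {c m : ℕ} (hp : WindowPal (letter W) c m) (d' : ℕ) : ∀ d < d', d' + m ≤ W.length →
      SameWindow (letter W) d c m → SameWindow (letter W) d' c m →
      (∀ k, d < k → k < d' → ¬ SameWindow (letter W) k c m) →
      WindowPal (letter W) d (d' - d + m) := by
  induction d' using Nat.strong_induction_on with
  | _ d' ih =>
  intro d hd hN hsd hsd' hno
  obtain ⟨a, l, hal, hpl, huni⟩ := exists_unioccurrent hr hN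
  have hml : m < l := by
    by_contra! hlm
    refine huni (a - (d' - d)) (by omega) fun t ht => ?_
    have h₁ := hsd (m - l + t) (by omega)
    rw [← hsd' (m - l + t) (by omega)] at h₁
    convert h₁ using 2 <;> omega
  have hpd' := hsd'.windowPal hp
  have hsa : SameWindow (letter W) a c m :=
    hpl.reflect hp hsd' (by omega) (by omega) (by omega)
  rcases lt_trichotomy a d with had | rfl | had
  · have hpa := ih (a + (d' - d)) (by omega) a (by omega) (by omega) hsa
      (hpl.reflect hp hsd (by omega) (by omega) (by omega)) fun k hk₁ hk₂ hk =>
        hno (a + d' - k) (by omega) (by omega)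
          (hpl.reflect hp hk (by omega) (by omega) (by omega))
    rw [show a + (d' - d) - a = d' - d by omega] at hpa
    exact (hpl.reflect hpa (fun _ _ => rfl) le_rfl (by omega) (by omega)).windowPal hpa
  · rwa [show d' - a + m = l by omega]
  · exact (hno a had (by omega) hsa).elim

/-- If all windows of length at most `m + 1` are balanced but two windows of length `m + 2` are
not, then these windows are of the form `1p1` and `0p0` with `p` a palindrome. -/
lemma exists_palindrome_of_unbalanced {w : ℕ → Bool} {N : ℕ}
    (hw : ∃ l i j, i + l ≤ N ∧ j + l ≤ N ∧
      (window w j l).count true + 2 ≤ (window w i l).count true) :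
    ∃ m i j, i + (m + 2) ≤ N ∧ j + (m + 2) ≤ N ∧ SameWindow w (i + 1) (j + 1) m ∧
      WindowPal w (i + 1) m ∧ w i = true ∧ w (i + (m + 1)) = true ∧
      w j = false ∧ w (j + (m + 1)) = false := by
  classical
  obtain ⟨i, j, hi, hj, hij⟩ := Nat.find_spec hw
  have hmin : ∀ l < Nat.find hw, ∀ a b, a + l ≤ N → b + l ≤ N →
      (window w a l).count true ≤ (window w b l).count true + 1 := by
    intro l hl a b ha hb
    by_contra! hlt
    exact Nat.find_min hw hl ⟨a, b, ha, hb, by omega⟩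
  generalize Nat.find hw = L at *
  obtain ⟨m, rfl⟩ : ∃ m, L = m + 2 := by
    refine ⟨L - 2, ?_⟩
    have : L ≠ 0 := by
      rintro rfl
      simp [window] at hij
    have : L ≠ 1 := by
      rintro rfl
      rw [count_window_one, count_window_one] at hij
      have := Bool.toNat_le (w i)
      omega
    omega
  have hsplit : ∀ s t, s + t = m + 2 → 0 < s → 0 < t →
      (window w i s).count true = (window w j s).count true + 1 ∧
      (window w (i + s) t).count true = (window w (j + s) t).count true + 1 := by
    intro s t hst hs ht
    rw [← hst, count_window_add, count_window_add] at hij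
    have := hmin s (by omega) i j (by omega) (by omega)
    have := hmin t (by omega) (i + s) (j + s) (by omega) (by omega)
    omega
  have hends : ∀ s t, s + t = m + 2 → 0 < s → 0 < t →
      (window w i s).count true = (window w (i + t) s).count true := by
    intro s t hst hs ht
    have := hsplit s t hst hs ht
    have := hsplit t s (by omega) ht hs
    have := hmin s (by omega) i (j + t) (by omega) (by omega)
    have := hmin s (by omega) (i + t) j (by omega) (by omega)
    omega
  have hfirst := (hsplit 1 (m + 1) (by omega) (by omega) (by omega)).1
  have hlast := (hsplit (m + 1) 1 (by omega) (by omega) (by omega)).2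
  simp only [count_window_one] at hfirst hlast
  refine ⟨m, i, j, hi, hj, fun t ht => ?_, fun t ht => ?_, ?_, ?_, ?_, ?_⟩
  · have h₁ := (hsplit (t + 1) (m + 1 - t) (by omega) (by omega) (by omega)).1
    have h₂ := (hsplit (t + 1 + 1) (m - t) (by omega) (by omega) (by omega)).1
    rw [count_window_add, count_window_add w j, count_window_one, count_window_one] at h₂
    apply toNat_injective
    rw [add_assoc i, add_assoc j, add_comm 1 t]
    omega
  · have h₁ := hends (t + 1) (m + 1 - t) (by omega) (by omega) (by omega)
    have h₂ := hends (t + 1 + 1) (m - t) (by omega) (by omega) (by omega)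
    rw [count_window_add, count_window_one, add_comm (t + 1) 1, count_window_add w (i + _),
      count_window_one] at h₂
    rw [show i + (m - t) + 1 = i + (m + 1 - t) by omega] at h₂
    apply toNat_injective
    rw [add_assoc i, add_comm 1 t, show i + 1 + (m - 1 - t) = i + (m - t) by omega]
    omega
  all_goals
    revert hfirst hlast
    cases w i <;> cases w j <;> cases w (i + (m + 1)) <;> cases w (j + (m + 1)) <;> simp

/-- A palindrome `p` cannot occur in `W` both as `1p1` and as `0p0`: all gaps between consecutive
occurrences of `p` span the same even palindrome. -/
theorem no_unbalanced_pair {W : List Bool} (hpal : Pal W)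
    (h : ∀ n : ℕ, n ≤ W.length → P W n + P W (W.length - n) = 2) {m i j : ℕ}
    (hi : i + (m + 2) ≤ W.length) (hj : j + (m + 2) ≤ W.length)
    (hs : SameWindow (letter W) (i + 1) (j + 1) m) (hp : WindowPal (letter W) (i + 1) m)
    (hi₁ : letter W i = !letter W j) (hi₂ : letter W (i + (m + 1)) = letter W i)
    (hj₂ : letter W (j + (m + 1)) = letter W j) (hij : i < j) : False := by
  have hr := card_palFactorFinset h
  generalize hw : letter W = w at *
  have hpj : WindowPal w (j + 1) m := fun t ht => by
    rw [← hs t ht, hp t ht, hs _ (by omega)]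
  have hext {k : ℕ} (hk : WindowPal w (k + 1) m) (hk₂ : w (k + (m + 1)) = w k) :
      WindowPal w k (m + 2) := by
    intro t ht
    rcases Nat.eq_zero_or_pos t with rfl | h0
    · simpa using hk₂.symm
    rcases Nat.lt_or_ge t (m + 1) with h1 | h1
    · have := hk (t - 1) (by omega)
      convert this using 2 <;> omega
    · obtain rfl : t = m + 1 := by omega
      simpa using hk₂
  have hpi' := hext hp hi₂
  have hpj' := hext hpj hj₂
  have hne : ¬ SameWindow w i j (m + 2) := fun hh => by
    have := hh 0 (by omega)
    simp [hi₁] at this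
  have hodd : Odd m := by
    rw [← Nat.not_even_iff_odd]
    intro he
    subst hw
    exact hne (same_of_even hpal h (by simpa [Nat.even_add] using he) hi hj hpi' hpj')
  have hgap : ∀ d d', d < d' → d' + m ≤ W.length → SameWindow w d (i + 1) m →
      SameWindow w d' (i + 1) m → (∀ k, d < k → k < d' → ¬ SameWindow w k (i + 1) m) →
      WindowPal w d (d' - d + m) ∧ Even (d' - d + m) := by
    intro d d' hd hN h₁ h₂ hno
    have hpd : WindowPal w d (d' - d + m) := by
      subst hw
      exact windowPal_of_consecutive hr hp d' d hd hN h₁ h₂ hno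
    refine ⟨hpd, ?_⟩
    by_contra ho
    obtain ⟨r, hr⟩ : ∃ r, d' - d = 2 * r + 2 := by
      obtain ⟨s, hs⟩ := hodd
      obtain ⟨s', hs'⟩ := Nat.not_even_iff_odd.1 ho
      exact ⟨s' - s - 1, by omega⟩
    have hc := hpd.center (r := r) (k := m + 2) (by omega)
    refine hno (d + r + 1) (by omega) (by omega) fun t ht => ?_
    have hor : SameWindow w i (d + r) (m + 2) ∨ SameWindow w j (d + r) (m + 2) := by
      subst hw
      exact same_or_same h hi hj (by omega) hpi' hpj' hc hne
    rcases hor with hh | hh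
    · have := hh (t + 1) (by omega)
      convert this.symm using 2 <;> ring
    · have := hh (t + 1) (by omega)
      rw [hs t ht]
      convert this.symm using 2 <;> ring
  have hgap_le : ∀ d₁ d₁' d₂ d₂', d₁ < d₁' → d₁' + m ≤ W.length → SameWindow w d₁ (i + 1) m →
      SameWindow w d₁' (i + 1) m → (∀ k, d₁ < k → k < d₁' → ¬ SameWindow w k (i + 1) m) →
      d₂ < d₂' → d₂' + m ≤ W.length → SameWindow w d₂ (i + 1) m →
      SameWindow w d₂' (i + 1) m → (∀ k, d₂ < k → k < d₂' → ¬ SameWindow w k (i + 1) m) →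
      d₂' - d₂ ≤ d₁' - d₁ := by
    intro d₁ d₁' d₂ d₂' hd₁ hN₁ h₁ h₁' hno₁ hd₂ hN₂ h₂ h₂' hno₂
    by_contra! hlt
    obtain ⟨hp₁, he₁⟩ := hgap d₁ d₁' hd₁ hN₁ h₁ h₁' hno₁
    obtain ⟨hp₂, he₂⟩ := hgap d₂ d₂' hd₂ hN₂ h₂ h₂' hno₂
    obtain ⟨r, hr⟩ : ∃ r, d₂' - d₂ + m = d₁' - d₁ + m + 2 * r := by
      obtain ⟨s, hs⟩ := he₁
      obtain ⟨s', hs'⟩ := he₂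
      exact ⟨s' - s, by omega⟩
    have hsame : SameWindow w (d₂ + r) d₁ (d₁' - d₁ + m) := by
      have hc := hp₂.center hr
      subst hw
      exact same_of_even hpal h he₁ (by omega) (by omega) hc hp₁
    exact hno₂ (d₂ + r) (by omega) (by omega) fun t ht =>
      (hsame t (by omega)).trans (h₁ t ht)
  classical
  have hex : ∃ x, i + 1 < x ∧ SameWindow w x (i + 1) m :=
    ⟨j + 1, by omega, fun t ht => (hs t ht).symm⟩
  obtain ⟨hx₁, hx₂⟩ := Nat.find_spec hex
  have hxj : Nat.find hex ≤ j + 1 := Nat.find_min' hex ⟨by omega, fun t ht => (hs t ht).symm⟩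
  have hxno : ∀ k, i + 1 < k → k < Nat.find hex → ¬ SameWindow w k (i + 1) m :=
    fun k hk₁ hk₂ hk => Nat.find_min hex hk₂ ⟨hk₁, hk⟩
  generalize Nat.find hex = x at *
  have hy₂ := Nat.findGreatest_spec (P := fun y => SameWindow w y (i + 1) m) (m := i + 1) (n := j)
    (by omega) (fun _ _ => rfl)
  have hyj := Nat.findGreatest_le (P := fun y => SameWindow w y (i + 1) m) j
  have hyno : ∀ k, Nat.findGreatest (fun y => SameWindow w y (i + 1) m) j < k → k < j + 1 →
      ¬ SameWindow w k (i + 1) m :=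
    fun k hk₁ hk₂ =>
      Nat.findGreatest_is_greatest (P := fun y => SameWindow w y (i + 1) m) hk₁ (by omega)
  generalize Nat.findGreatest (fun y => SameWindow w y (i + 1) m) j = y at *
  have hsj : SameWindow w (j + 1) (i + 1) m := fun t ht => (hs t ht).symm
  have hsi : SameWindow w (i + 1) (i + 1) m := fun _ _ => rfl
  have hle₁ := hgap_le (i + 1) x y (j + 1) hx₁ (by omega) hsi hx₂ hxno (by omega) (by omega)
    hy₂ hsj hyno
  have hle₂ := hgap_le y (j + 1) (i + 1) x (by omega) (by omega) hy₂ hsj hyno hx₁ (by omega)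
    hsi hx₂ hxno
  obtain ⟨hpx, hev⟩ := hgap (i + 1) x hx₁ (by omega) hsi hx₂ hxno
  obtain ⟨hpy, -⟩ := hgap y (j + 1) (by omega) (by omega) hy₂ hsj hyno
  rw [show j + 1 - y = x - (i + 1) by omega] at hpy
  have hsame : SameWindow w (i + 1) y (x - (i + 1) + m) := by
    subst hw
    exact same_of_even hpal h hev (by omega) (by omega) hpx hpy
  have h₁ := hsame m (by omega)
  have h₂ := hpy m (by omega)
  rw [show i + 1 + m = i + (m + 1) by ring, hi₂, hi₁, h₂,
    show y + (x - (i + 1) + m - 1 - m) = j by omega] at h₁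
  simp at h₁

end PalComplexity

open PalComplexity in
theorem stmt11 (W : List Bool) (hpal : Pal W)
    (h : ∀ n : ℕ, n ≤ W.length → P W n + P W (W.length - n) = 2) :
    BalancedWord W := by
  intro u v hu hv hl
  by_contra! hlt
  obtain ⟨a, ha, hu⟩ := isInfix_iff.1 hu
  obtain ⟨b, hb, hv⟩ := isInfix_iff.1 hv
  obtain ⟨m, i, j, hi, hj, hs, hp, hi₁, hi₂, hj₁, hj₂⟩ :=
    exists_palindrome_of_unbalanced (w := letter W) (N := W.length)
      ⟨u.length, a, b, ha, by omega, by rw [← hu, hl, ← hv]; omega⟩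
  rcases lt_trichotomy i j with hij | rfl | hij
  · exact no_unbalanced_pair hpal h hi hj hs hp (by simp [hi₁, hj₁]) (by simp [hi₁, hi₂])
      (by simp [hj₁, hj₂]) hij
  · simp [hi₁] at hj₁
  · exact no_unbalanced_pair hpal h hj hi (fun t ht => (hs t ht).symm)
      (SameWindow.windowPal (fun t ht => (hs t ht).symm) hp)
      (by simp [hi₁, hj₁]) (by simp [hj₁, hj₂]) (by simp [hi₁, hi₂]) hij
end
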